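/- Suppose ε = 0. Then K^n = Ω^n × G^{n−1} with D(α,β) = (dα, dβ), so H^n(K) ≅ H^n(Ω) ⊕ H^{n−1}(G); and for every n there is an isomorphism H^n(C) ≅ H^n(Ω) ⊕ ⊕_{j≥1} H^{n−2j}(𝒦). Under this isomorphism the ℝ[u]-module structure of H^*(C) is given by u · (b₀, b̄₁, b̄₂, …) = (0, Pr(b₀), b̄₁, b̄₂, …), where b₀ ∈ H^n(Ω), b̄_j ∈ H^{n−2j}(𝒦), and Pr : H^n(Ω) → H^n(𝒦) is induced by the projection Ω → 𝒦. -/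

import Mathlib

/-!
Common algebraic model for the paper "Intersection cohomology of circle actions"
(Padilla–Saralegi), following the CONTEXT of the statements.

`A` models the (total space of the) graded-commutative differential graded ℝ-algebra
`A = ⊕ₙ Aⁿ` of liftable forms on the orbit space `B`; the grading is only recorded
through the families of graded subspaces `P Q : ℤ → Submodule ℝ A` (the forms of
perverse degree `≤ p̄` resp. `≤ p̄ - x̄`), which vanish in negative degrees
(`Aⁿ = 0` for `n < 0`).  The differential is `d` with `d ∘ d = 0`, and
`e : A →ₗ[ℝ] A` is right multiplication by the fixed Euler form `ε ∈ A²`;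
the hypotheses `dε = 0` together with the graded Leibniz rule amount exactly to
the commutation `d ∘ e = e ∘ d`, which is how we encode them.
-/

open Submodule LinearMap

noncomputable section

namespace IG

variable {A : Type*} [AddCommGroup A] [Module ℝ A]

/-- `Ω^n = {α ∈ P^n : dα ∈ P^(n+1)}`. -/
def Om (d : A →ₗ[ℝ] A) (P : ℤ → Submodule ℝ A) (n : ℤ) : Submodule ℝ A :=
  P n ⊓ (P (n + 1)).comap d

/-- First component of `D` in degree `n` : `(α, β) ↦ dα + (-1)^(n-1) β∧ε`. -/
def D1 (d e : A →ₗ[ℝ] A) (n : ℤ) : A × A →ₗ[ℝ] A :=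
  d ∘ₗ LinearMap.fst ℝ A A + ((-1 : ℝ) ^ (n - 1)) • (e ∘ₗ LinearMap.snd ℝ A A)

/-- `D(α,β) = (dα + (-1)^(n-1) β∧ε, dβ)` in degree `n`. -/
def Dmap (d e : A →ₗ[ℝ] A) (n : ℤ) : A × A →ₗ[ℝ] A × A :=
  (D1 d e n).prod (d ∘ₗ LinearMap.snd ℝ A A)

/-- `K^n = {(α,β) ∈ P^n × Q^(n-1) : dβ ∈ Q^n, dα + (-1)^(n-1) β∧ε ∈ P^(n+1)}`. -/
def Ksub (d e : A →ₗ[ℝ] A) (P Q : ℤ → Submodule ℝ A) (n : ℤ) : Submodule ℝ (A × A) :=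
  (P n).comap (LinearMap.fst ℝ A A) ⊓ (Q (n - 1)).comap (LinearMap.snd ℝ A A) ⊓
    (Q n).comap (d ∘ₗ LinearMap.snd ℝ A A) ⊓ (P (n + 1)).comap (D1 d e n)

/-- `G^n = {β ∈ Q^n : dβ ∈ Q^(n+1), ∃ α ∈ P^(n+1), dα + (-1)^n β∧ε ∈ P^(n+2)}`. -/
def Gsub (d e : A →ₗ[ℝ] A) (P Q : ℤ → Submodule ℝ A) (n : ℤ) : Submodule ℝ A :=
  Q n ⊓ (Q (n + 1)).comap d ⊓
    (((P (n + 1)).comap (LinearMap.fst ℝ A A) ⊓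
        (P (n + 2)).comap
          (d ∘ₗ LinearMap.fst ℝ A A + ((-1 : ℝ) ^ n) • (e ∘ₗ LinearMap.snd ℝ A A))).map
      (LinearMap.snd ℝ A A))

/-- `C^m = ⊕_{i+2j=m} K^i ⊗ ℝ·u^j`, realized as the functions `ω : ℕ → A × A`
(`ω j` = the coefficient of `u^j`) with `ω j ∈ K^(m-2j)` for all `j`. -/
def Csub (d e : A →ₗ[ℝ] A) (P Q : ℤ → Submodule ℝ A) (m : ℤ) : Submodule ℝ (ℕ → A × A) :=
  ⨅ j : ℕ, (Ksub d e P Q (m - 2 * (j : ℤ))).comap (LinearMap.proj (R := ℝ) j)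

/-- `∇((α,β) ⊗ u^j) = D(α,β) ⊗ u^j + (-1)^(n-1) (β,0) ⊗ u^(j+1)` on total degree `m`. -/
def nabla (d e : A →ₗ[ℝ] A) (m : ℤ) : (ℕ → A × A) →ₗ[ℝ] (ℕ → A × A) :=
  LinearMap.pi fun j : ℕ =>
    Dmap d e (m - 2 * (j : ℤ)) ∘ₗ LinearMap.proj j +
      if j = 0 then 0
      else ((-1 : ℝ) ^ (m - 2 * ((j : ℤ) - 1) - 1)) •
        (LinearMap.inl ℝ A A ∘ₗ LinearMap.snd ℝ A A ∘ₗ LinearMap.proj (j - 1))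

/-- Multiplication by `u` (degree 2) on an `ℝ[u]`-module realized as `ℕ → M`. -/
def shiftL (M : Type*) [AddCommGroup M] [Module ℝ M] : (ℕ → M) →ₗ[ℝ] (ℕ → M) :=
  LinearMap.pi fun j : ℕ => if j = 0 then 0 else LinearMap.proj (j - 1)

/-- `π' (α ⊗ u^j) = (α, 0) ⊗ u^j`. -/
def piMap : (ℕ → A) →ₗ[ℝ] ℕ → A × A :=
  LinearMap.pi fun j : ℕ => LinearMap.inl ℝ A A ∘ₗ LinearMap.proj j

/-- `∮' ((α,β) ⊗ u^j) = β ⊗ u^j`. -/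
def ointMap : (ℕ → A × A) →ₗ[ℝ] ℕ → A :=
  LinearMap.pi fun j : ℕ => LinearMap.snd ℝ A A ∘ₗ LinearMap.proj j

/-- `d ⊗ 1`. -/
def dpi (d : A →ₗ[ℝ] A) : (ℕ → A) →ₗ[ℝ] ℕ → A :=
  LinearMap.pi fun j : ℕ => d ∘ₗ LinearMap.proj j

/-- `(Ω ⊗ ℝ[u])^m`. -/
def OmC (d : A →ₗ[ℝ] A) (P : ℤ → Submodule ℝ A) (m : ℤ) : Submodule ℝ (ℕ → A) :=
  ⨅ j : ℕ, (Om d P (m - 2 * (j : ℤ))).comap (LinearMap.proj (R := ℝ) j)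

/-- `(G[-1] ⊗ ℝ[u])^m` (`G[-1]` places `G^n` in degree `n+1`). -/
def GCs (d e : A →ₗ[ℝ] A) (P Q : ℤ → Submodule ℝ A) (m : ℤ) : Submodule ℝ (ℕ → A) :=
  ⨅ j : ℕ, (Gsub d e P Q (m - 1 - 2 * (j : ℤ))).comap (LinearMap.proj (R := ℝ) j)

/-- Cohomology presented as (cocycles) / (coboundaries). -/
abbrev Hq {M : Type*} [AddCommGroup M] [Module ℝ M] (Z B : Submodule ℝ M) :=
  Z ⧸ (B.comap Z.subtype)

/-- Cocycles of `Ω`. -/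
def ZOm (d : A →ₗ[ℝ] A) (P : ℤ → Submodule ℝ A) (n : ℤ) : Submodule ℝ A :=
  Om d P n ⊓ LinearMap.ker d

/-- Coboundaries of `Ω`. -/
def BOm (d : A →ₗ[ℝ] A) (P : ℤ → Submodule ℝ A) (n : ℤ) : Submodule ℝ A :=
  (Om d P (n - 1)).map d

/-- `H^n(Ω)`. -/
abbrev HOm (d : A →ₗ[ℝ] A) (P : ℤ → Submodule ℝ A) (n : ℤ) :=
  Hq (ZOm d P n) (BOm d P n)

/-- Cocycles of `G`. -/
def ZG (d e : A →ₗ[ℝ] A) (P Q : ℤ → Submodule ℝ A) (n : ℤ) : Submodule ℝ A :=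
  Gsub d e P Q n ⊓ LinearMap.ker d

/-- Coboundaries of `G`. -/
def BG (d e : A →ₗ[ℝ] A) (P Q : ℤ → Submodule ℝ A) (n : ℤ) : Submodule ℝ A :=
  (Gsub d e P Q (n - 1)).map d

/-- `H^n(G)`. -/
abbrev HG (d e : A →ₗ[ℝ] A) (P Q : ℤ → Submodule ℝ A) (n : ℤ) :=
  Hq (ZG d e P Q n) (BG d e P Q n)

/-- The co-Gysin space `𝒦^n = Ω^n / G^n` (cochain level). -/
abbrev Kq (d e : A →ₗ[ℝ] A) (P Q : ℤ → Submodule ℝ A) (n : ℤ) :=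
  (Om d P n) ⧸ ((Gsub d e P Q n).comap (Om d P n).subtype)

/-- Cocycles of the co-Gysin complex `𝒦 = Ω/G`, presented by representatives:
`α ∈ Ω^n` with `dα ∈ G^(n+1)`. -/
def ZKo (d e : A →ₗ[ℝ] A) (P Q : ℤ → Submodule ℝ A) (n : ℤ) : Submodule ℝ A :=
  Om d P n ⊓ (Gsub d e P Q (n + 1)).comap d

/-- Representatives of coboundaries of `𝒦 = Ω/G`. -/
def BKo (d e : A →ₗ[ℝ] A) (P Q : ℤ → Submodule ℝ A) (n : ℤ) : Submodule ℝ A :=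
  Gsub d e P Q n ⊔ (Om d P (n - 1)).map d

/-- `H^n(𝒦)`. -/
abbrev HKo (d e : A →ₗ[ℝ] A) (P Q : ℤ → Submodule ℝ A) (n : ℤ) :=
  Hq (ZKo d e P Q n) (BKo d e P Q n)

/-- Cocycles of `(C, ∇)`. -/
def ZC (d e : A →ₗ[ℝ] A) (P Q : ℤ → Submodule ℝ A) (m : ℤ) : Submodule ℝ (ℕ → A × A) :=
  Csub d e P Q m ⊓ LinearMap.ker (nabla d e m)

/-- Coboundaries of `(C, ∇)`. -/
def BC (d e : A →ₗ[ℝ] A) (P Q : ℤ → Submodule ℝ A) (m : ℤ) : Submodule ℝ (ℕ → A × A) :=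
  (Csub d e P Q (m - 1)).map (nabla d e (m - 1))

/-- `H^m(C)`, the equivariant intersection cohomology. -/
abbrev HC (d e : A →ₗ[ℝ] A) (P Q : ℤ → Submodule ℝ A) (m : ℤ) :=
  Hq (ZC d e P Q m) (BC d e P Q m)

/-- Cocycles of `(Ω ⊗ ℝ[u], d ⊗ 1)`. -/
def ZOmC (d : A →ₗ[ℝ] A) (P : ℤ → Submodule ℝ A) (m : ℤ) : Submodule ℝ (ℕ → A) :=
  OmC d P m ⊓ LinearMap.ker (dpi d)

/-- Coboundaries of `(Ω ⊗ ℝ[u], d ⊗ 1)`. -/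
def BOmC (d : A →ₗ[ℝ] A) (P : ℤ → Submodule ℝ A) (m : ℤ) : Submodule ℝ (ℕ → A) :=
  (OmC d P (m - 1)).map (dpi d)

/-- `[H(Ω) ⊗ ℝ[u]]^m`, as the cohomology of the complex `(Ω ⊗ ℝ[u], d ⊗ 1)`. -/
abbrev HOmCq (d : A →ₗ[ℝ] A) (P : ℤ → Submodule ℝ A) (m : ℤ) :=
  Hq (ZOmC d P m) (BOmC d P m)

/-- Cocycles of `(G[-1] ⊗ ℝ[u], d ⊗ 1)`. -/
def ZGC (d e : A →ₗ[ℝ] A) (P Q : ℤ → Submodule ℝ A) (m : ℤ) : Submodule ℝ (ℕ → A) :=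
  GCs d e P Q m ⊓ LinearMap.ker (dpi d)

/-- Coboundaries of `(G[-1] ⊗ ℝ[u], d ⊗ 1)`. -/
def BGC (d e : A →ₗ[ℝ] A) (P Q : ℤ → Submodule ℝ A) (m : ℤ) : Submodule ℝ (ℕ → A) :=
  (GCs d e P Q (m - 1)).map (dpi d)

/-- `[H(G) ⊗ ℝ[u]]^(m-1)`, as the cohomology of `(G[-1] ⊗ ℝ[u], d ⊗ 1)` in degree `m`. -/
abbrev HGCq (d e : A →ₗ[ℝ] A) (P Q : ℤ → Submodule ℝ A) (m : ℤ) :=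
  Hq (ZGC d e P Q m) (BGC d e P Q m)

/-- The subspace of `ω : ℕ → A × A` supported in (filtration) degrees `≥ i`
(for total degree `m`): `ω j = 0` whenever `m - 2j < i`. -/
def Supp (i m : ℤ) : Submodule ℝ (ℕ → A × A) :=
  ⨅ (j : ℕ) (_ : m - 2 * (j : ℤ) < i),
    LinearMap.ker (LinearMap.proj (R := ℝ) (φ := fun _ : ℕ => A × A) j)

/-- The filtration `F^i C^m = {ω ∈ ⊕_{i'≥i} K^{i'} ⊗ ℝ[u] of total degree m :
∇ω ∈ ⊕_{i'≥i} K^{i'} ⊗ ℝ[u]}`. -/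
def FC (d e : A →ₗ[ℝ] A) (P Q : ℤ → Submodule ℝ A) (i m : ℤ) : Submodule ℝ (ℕ → A × A) :=
  Csub d e P Q m ⊓ Supp i m ⊓ (Supp i (m + 1)).comap (nabla d e m)

/-- `Z_r^{i,j} = F^i C^(i+j) ∩ ∇⁻¹(F^(i+r) C^(i+j+1))`. -/
def Zsp (d e : A →ₗ[ℝ] A) (P Q : ℤ → Submodule ℝ A) (r i j : ℤ) : Submodule ℝ (ℕ → A × A) :=
  FC d e P Q i (i + j) ⊓ (FC d e P Q (i + r) (i + j + 1)).comap (nabla d e (i + j))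

/-- `B_r^{i,j} = F^i C^(i+j) ∩ ∇(F^(i-r) C^(i+j-1))`. -/
def Bsp (d e : A →ₗ[ℝ] A) (P Q : ℤ → Submodule ℝ A) (r i j : ℤ) : Submodule ℝ (ℕ → A × A) :=
  FC d e P Q i (i + j) ⊓ (FC d e P Q (i - r) (i + j - 1)).map (nabla d e (i + j - 1))

/-- `E_r^{i,j} = Z_r^{i,j} / (Z_(r-1)^{i+1,j-1} + B_(r-1)^{i,j})`. -/
abbrev Esp (d e : A →ₗ[ℝ] A) (P Q : ℤ → Submodule ℝ A) (r i j : ℤ) :=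
  Zsp d e P Q r i j ⧸
    ((Zsp d e P Q (r - 1) (i + 1) (j - 1) ⊔ Bsp d e P Q (r - 1) i j).comap
      (Zsp d e P Q r i j).subtype)

/-- The differential `d_r : E_r^{i,j} → E_r^{i+r,j-r+1}` is the map induced by `∇`
(the target indices `(i', j')` are given freely, to be instantiated by
expressions equal to `(i + r, j - r + 1)`). -/
def DrChar (d e : A →ₗ[ℝ] A) (P Q : ℤ → Submodule ℝ A) (r i j i' j' : ℤ)
    (dr : Esp d e P Q r i j →ₗ[ℝ] Esp d e P Q r i' j') : Prop :=
  ∀ (ω : ℕ → A × A) (hω : ω ∈ Zsp d e P Q r i j)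
    (hω' : nabla d e (i + j) ω ∈ Zsp d e P Q r i' j'),
    dr (Submodule.Quotient.mk ⟨ω, hω⟩) = Submodule.Quotient.mk ⟨nabla d e (i + j) ω, hω'⟩

/-- `α ↦ (α, 0) ⊗ u^0 = (α,0) ⊗ 1`. -/
def embL : A →ₗ[ℝ] ℕ → A × A :=
  LinearMap.single ℝ (fun _ : ℕ => A × A) 0 ∘ₗ LinearMap.inl ℝ A A

/-- `ι̃ : H^n(G) → H^{n'}(Ω)` induced by the inclusion `G ⊆ Ω` (`n' = n`). -/
def iotaChar (d e : A →ₗ[ℝ] A) (P Q : ℤ → Submodule ℝ A) (n n' : ℤ)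
    (ι : HG d e P Q n →ₗ[ℝ] HOm d P n') : Prop :=
  ∀ (β : A) (hβ : β ∈ ZG d e P Q n) (hβ' : β ∈ ZOm d P n'),
    ι (Submodule.Quotient.mk ⟨β, hβ⟩) = Submodule.Quotient.mk ⟨β, hβ'⟩

/-- `𝕖 : H^n(G) → H^{n'}(Ω)`, `𝕖[β] = [dα + (-1)^n β∧ε]` for any witness `α`
(`n' = n + 2`). -/
def eulerChar (d e : A →ₗ[ℝ] A) (P Q : ℤ → Submodule ℝ A) (n n' : ℤ)
    (E : HG d e P Q n →ₗ[ℝ] HOm d P n') : Prop :=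
  ∀ (β : A) (hβ : β ∈ ZG d e P Q n) (α : A) (_ : α ∈ P (n + 1))
    (hz : d α + ((-1 : ℝ) ^ n) • e β ∈ ZOm d P n'),
    E (Submodule.Quotient.mk ⟨β, hβ⟩) =
      Submodule.Quotient.mk ⟨d α + ((-1 : ℝ) ^ n) • e β, hz⟩

/-- `∂ : H^n(𝒦) → H^{n'}(G)`, `∂[ᾱ] = [dα]` (`n' = n + 1`). -/
def partialChar (d e : A →ₗ[ℝ] A) (P Q : ℤ → Submodule ℝ A) (n n' : ℤ)
    (pd : HKo d e P Q n →ₗ[ℝ] HG d e P Q n') : Prop :=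
  ∀ (α : A) (hα : α ∈ ZKo d e P Q n) (hd : d α ∈ ZG d e P Q n'),
    pd (Submodule.Quotient.mk ⟨α, hα⟩) = Submodule.Quotient.mk ⟨d α, hd⟩

/-- `Pr : H^n(Ω) → H^{n'}(𝒦)` induced by the projection `Ω → 𝒦 = Ω/G` (`n' = n`). -/
def prChar (d e : A →ₗ[ℝ] A) (P Q : ℤ → Submodule ℝ A) (n n' : ℤ)
    (pr : HOm d P n →ₗ[ℝ] HKo d e P Q n') : Prop :=
  ∀ (α : A) (hα : α ∈ ZOm d P n) (hα' : α ∈ ZKo d e P Q n'),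
    pr (Submodule.Quotient.mk ⟨α, hα⟩) = Submodule.Quotient.mk ⟨α, hα'⟩

/-- Cocycles of the complex `(K, D)`. -/
def ZKc {A : Type*} [AddCommGroup A] [Module ℝ A]
    (d e : A →ₗ[ℝ] A) (P Q : ℤ → Submodule ℝ A) (n : ℤ) : Submodule ℝ (A × A) :=
  Ksub d e P Q n ⊓ LinearMap.ker (Dmap d e n)

/-- Coboundaries of the complex `(K, D)`. -/
def BKc {A : Type*} [AddCommGroup A] [Module ℝ A]
    (d e : A →ₗ[ℝ] A) (P Q : ℤ → Submodule ℝ A) (n : ℤ) : Submodule ℝ (A × A) :=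
  (Ksub d e P Q (n - 1)).map (Dmap d e (n - 1))

/-- `H^n(K)`. -/
abbrev HKc {A : Type*} [AddCommGroup A] [Module ℝ A]
    (d e : A →ₗ[ℝ] A) (P Q : ℤ → Submodule ℝ A) (n : ℤ) :=
  Hq (ZKc d e P Q n) (BKc d e P Q n)

section VanishingEuler

variable {d : A →ₗ[ℝ] A} {P Q : ℤ → Submodule ℝ A}

lemma neg_one_zpow_mul_self (m : ℤ) : ((-1 : ℝ) ^ m) * (-1) ^ m = 1 := by
  rw [← mul_zpow]; simp

lemma neg_one_zpow_smul_smul (m : ℤ) (a : A) : ((-1 : ℝ) ^ m) • ((-1 : ℝ) ^ m) • a = a := by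
  rw [smul_smul, neg_one_zpow_mul_self, one_smul]

lemma mem_Om {n : ℤ} {α : A} : α ∈ Om d P n ↔ α ∈ P n ∧ d α ∈ P (n + 1) := Iff.rfl

lemma mem_Gsub_zero {n : ℤ} {β : A} :
    β ∈ Gsub d 0 P Q n ↔ β ∈ Q n ∧ d β ∈ Q (n + 1) := by
  constructor
  · rintro ⟨h, -⟩
    exact h
  · intro h
    refine ⟨h, (0, β), ⟨?_, ?_⟩, rfl⟩ <;> simp

lemma D1_zero_apply (n : ℤ) (x : A × A) : D1 d 0 n x = d x.1 := by simp [D1]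

lemma Dmap_zero_apply (n : ℤ) (x : A × A) : Dmap d 0 n x = (d x.1, d x.2) := by
  simp [Dmap, D1_zero_apply]

lemma mem_Ksub_zero {n : ℤ} {x : A × A} :
    x ∈ Ksub d 0 P Q n ↔ x.1 ∈ Om d P n ∧ x.2 ∈ Gsub d 0 P Q (n - 1) := by
  simp only [Ksub, mem_inf, mem_comap, D1_zero_apply, mem_Om, mem_Gsub_zero, sub_add_cancel,
    LinearMap.comp_apply, LinearMap.fst_apply, LinearMap.snd_apply]
  tauto

lemma mem_Csub {m : ℤ} {ω : ℕ → A × A} :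
    ω ∈ Csub d 0 P Q m ↔ ∀ j : ℕ, (ω j).1 ∈ Om d P (m - 2 * (j : ℤ)) ∧
      (ω j).2 ∈ Gsub d 0 P Q (m - 2 * (j : ℤ) - 1) := by
  simp [Csub, mem_Ksub_zero]

lemma nabla_zero_apply_zero (m : ℤ) (ω : ℕ → A × A) :
    nabla d 0 m ω 0 = (d (ω 0).1, d (ω 0).2) := by
  simp [nabla, Dmap_zero_apply]

lemma nabla_zero_apply_succ (m : ℤ) (ω : ℕ → A × A) (j : ℕ) :
    nabla d 0 m ω (j + 1) =
      (d (ω (j + 1)).1 - ((-1 : ℝ) ^ m) • (ω j).2, d (ω (j + 1)).2) := by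
  have h : ((-1 : ℝ) ^ (m - 2 * (((j + 1 : ℕ) : ℤ) - 1) - 1)) = -(-1) ^ m := by
    have h' : m - 2 * (((j + 1 : ℕ) : ℤ) - 1) - 1 = m + 2 * (-(j : ℤ)) - 1 := by
      push_cast; ring
    rw [h', zpow_sub₀ (by norm_num), zpow_add₀ (by norm_num), zpow_mul]
    simp [div_neg]
  have e : nabla d 0 m ω (j + 1) = Dmap d 0 (m - 2 * ((j + 1 : ℕ) : ℤ)) (ω (j + 1)) +
      ((-1 : ℝ) ^ (m - 2 * (((j + 1 : ℕ) : ℤ) - 1) - 1)) • ((ω j).2, (0 : A)) := by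
    simp [nabla]
  rw [e, h, Dmap_zero_apply]
  ext <;> simp [sub_eq_add_neg]

/-- A cocycle of `C` is determined by the first components of its coefficients. -/
lemma mem_ZC_zero_iff (hd : d ∘ₗ d = 0) {m : ℤ} {ω : ℕ → A × A} :
    ω ∈ ZC d 0 P Q m ↔ (ω 0).1 ∈ ZOm d P m ∧ ∀ j : ℕ,
      (ω (j + 1)).1 ∈ ZKo d 0 P Q (m - 2 * ((j : ℤ) + 1)) ∧
        (ω j).2 = ((-1 : ℝ) ^ m) • d (ω (j + 1)).1 := by
  have hdd (a : A) : d (d a) = 0 := LinearMap.congr_fun hd a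
  have hdeg (j : ℕ) : m - 2 * ((j : ℤ) + 1) + 1 = m - 2 * (j : ℤ) - 1 := by ring
  constructor
  · rintro ⟨hC, hk⟩
    rw [SetLike.mem_coe, mem_Csub] at hC
    have hk' : nabla d 0 m ω = 0 := hk
    have hβ (j : ℕ) : (ω j).2 = ((-1 : ℝ) ^ m) • d (ω (j + 1)).1 := by
      have h := congr_arg Prod.fst (congr_fun hk' (j + 1))
      rw [nabla_zero_apply_succ] at h
      rw [sub_eq_zero.1 h, neg_one_zpow_smul_smul]
    refine ⟨⟨?_, ?_⟩, fun j => ⟨⟨?_, ?_⟩, hβ j⟩⟩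
    · simpa using (hC 0).1
    · have h := congr_arg Prod.fst (congr_fun hk' 0)
      rwa [nabla_zero_apply_zero] at h
    · exact (hC (j + 1)).1
    · rw [SetLike.mem_coe, mem_comap, hdeg,
        ← neg_one_zpow_smul_smul m (d (ω (j + 1)).1), ← hβ j]
      exact Submodule.smul_mem _ _ (hC j).2
  · rintro ⟨h0, h⟩
    refine ⟨mem_Csub.2 fun j => ⟨?_, ?_⟩, ?_⟩
    · cases j with
      | zero => simpa using h0.1
      | succ j => exact (h j).1.1
    · have hG := (h j).1.2
      rw [SetLike.mem_coe, mem_comap, hdeg] at hG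
      rw [(h j).2]
      exact Submodule.smul_mem _ _ hG
    · change nabla d 0 m ω = 0
      have hβ (j : ℕ) : d (ω j).2 = 0 := by rw [(h j).2, map_smul, hdd, smul_zero]
      ext1 j
      cases j with
      | zero =>
        rw [nabla_zero_apply_zero, hβ, LinearMap.mem_ker.1 h0.2]
        rfl
      | succ j =>
        rw [nabla_zero_apply_succ, hβ, (h j).2, neg_one_zpow_smul_smul, sub_self]
        rfl

lemma mem_BC_zero_iff (hd : d ∘ₗ d = 0) {m : ℤ} {ω : ℕ → A × A} (hω : ω ∈ ZC d 0 P Q m) :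
    ω ∈ BC d 0 P Q m ↔ (ω 0).1 ∈ BOm d P m ∧ ∀ j : ℕ,
      (ω (j + 1)).1 ∈ BKo d 0 P Q (m - 2 * ((j : ℤ) + 1)) := by
  have hdd (a : A) : d (d a) = 0 := LinearMap.congr_fun hd a
  have hdeg (j : ℕ) : m - 2 * ((j : ℤ) + 1) = m - 1 - 2 * (j : ℤ) - 1 := by ring
  have hdeg' (j : ℕ) : m - 2 * ((j : ℤ) + 1) - 1 = m - 1 - 2 * ((j + 1 : ℕ) : ℤ) := by
    push_cast; ring
  have hsign : ((-1 : ℝ) ^ (m - 1)) = -(-1) ^ m := by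
    rw [zpow_sub₀ (by norm_num)]; simp [div_neg]
  constructor
  · rintro ⟨η, hη, rfl⟩
    rw [SetLike.mem_coe, mem_Csub] at hη
    refine ⟨⟨(η 0).1, ?_, ?_⟩, fun j => ?_⟩
    · simpa using (hη 0).1
    · rw [nabla_zero_apply_zero]
    · rw [nabla_zero_apply_succ, hsign, neg_smul, sub_neg_eq_add, add_comm (d _)]
      refine Submodule.add_mem_sup (Submodule.smul_mem _ _ ?_) (Submodule.mem_map_of_mem ?_)
      · rw [hdeg]
        exact (hη j).2
      · rw [hdeg']
        exact (hη (j + 1)).1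
  · rintro ⟨⟨a, ha, ha'⟩, h⟩
    have h' (j : ℕ) : ∃ b ∈ Gsub d 0 P Q (m - 2 * ((j : ℤ) + 1)),
        ∃ c ∈ Om d P (m - 2 * ((j : ℤ) + 1) - 1), b + d c = (ω (j + 1)).1 := by
      obtain ⟨b, hb, _, ⟨c, hc, rfl⟩, hbc⟩ := Submodule.mem_sup.1 (h j)
      exact ⟨b, hb, c, hc, hbc⟩
    choose b hb c hc hbc using h'
    have hβ (j : ℕ) : ((-1 : ℝ) ^ m) • d (b j) = (ω j).2 := by
      rw [(((mem_ZC_zero_iff hd).1 hω).2 j).2, ← hbc, map_add, hdd, add_zero]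
    refine ⟨fun j => (Nat.casesOn j a c, ((-1 : ℝ) ^ m) • b j), mem_Csub.2 fun j => ⟨?_, ?_⟩, ?_⟩
    · cases j with
      | zero => simpa using ha
      | succ j => exact hdeg' j ▸ hc j
    · exact Submodule.smul_mem _ _ (hdeg j ▸ hb j)
    · ext1 j
      cases j with
      | zero =>
        rw [nabla_zero_apply_zero, map_smul, hβ]
        exact Prod.ext ha' rfl
      | succ j =>
        rw [nabla_zero_apply_succ, map_smul, hβ, hsign, neg_smul, neg_one_zpow_smul_smul,
          sub_neg_eq_add, add_comm]
        exact Prod.ext (hbc j) rfl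

lemma ZOm_le_ZKo (m : ℤ) : ZOm d P m ≤ ZKo d 0 P Q m := fun α h =>
  ⟨h.1, by rw [SetLike.mem_coe, mem_comap, LinearMap.mem_ker.1 h.2]; exact Submodule.zero_mem _⟩

lemma shiftL_mem_ZC (hd : d ∘ₗ d = 0) {m : ℤ} {ω : ℕ → A × A} (hω : ω ∈ ZC d 0 P Q m) :
    shiftL (A × A) ω ∈ ZC d 0 P Q (m + 2) := by
  obtain ⟨h0, h⟩ := (mem_ZC_zero_iff hd).1 hω
  have hsucc (j : ℕ) : shiftL (A × A) ω (j + 1) = ω j := by simp [shiftL]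
  have hzero : shiftL (A × A) ω 0 = 0 := by simp [shiftL]
  have hsign : ((-1 : ℝ) ^ (m + 2)) = (-1) ^ m := by
    rw [zpow_add₀ (by norm_num)]; simp
  have hdeg (j : ℕ) : m + 2 - 2 * ((j : ℤ) + 1) = m - 2 * (j : ℤ) := by ring
  refine (mem_ZC_zero_iff hd).2 ⟨by rw [hzero]; exact Submodule.zero_mem _, fun j => ⟨?_, ?_⟩⟩
  · rw [hsucc, hdeg]
    cases j with
    | zero => simpa using ZOm_le_ZKo m h0
    | succ j => exact (h j).1
  · rw [hsucc, hsign]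
    cases j with
    | zero => rw [hzero, LinearMap.mem_ker.1 h0.2, smul_zero]; rfl
    | succ j => rw [hsucc]; exact (h j).2

lemma subsingleton_HKo (hPneg : ∀ n : ℤ, n < 0 → P n = ⊥) {k : ℤ} (hk : k < 0) :
    Subsingleton (HKo d 0 P Q k) := by
  have : Subsingleton (ZKo d 0 P Q k) := by
    refine (Submodule.subsingleton_iff_eq_bot).2 (eq_bot_iff.2 fun α h => ?_)
    rw [← hPneg k hk]
    exact h.1.1
  exact (Submodule.mkQ_surjective _).subsingleton

end VanishingEuler

/-- Descending a surjection on cocycles whose kernel is the space of coboundaries. -/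
lemma exists_Hq_equiv {M N : Type*} [AddCommGroup M] [Module ℝ M] [AddCommGroup N] [Module ℝ N]
    {Z B : Submodule ℝ M} (f : Z →ₗ[ℝ] N) (hf : Function.Surjective f)
    (hB : ∀ z : Z, f z = 0 ↔ (z : M) ∈ B) :
    ∃ Θ : Hq Z B ≃ₗ[ℝ] N, ∀ z : Z, Θ (Submodule.Quotient.mk z) = f z := by
  have hker : B.comap Z.subtype = LinearMap.ker f := by
    ext z
    exact (hB z).symm
  exact ⟨(Submodule.quotEquivOfEq _ _ hker).trans (f.quotKerEquivOfSurjective hf), fun z => rfl⟩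

open DirectSum in
/-- A product of modules almost all of which vanish is their direct sum. -/
lemma exists_pi_equiv_directSum {M : ℕ → Type*} [∀ j, AddCommGroup (M j)] [∀ j, Module ℝ (M j)]
    (N : ℕ) (hM : ∀ j, N ≤ j → Subsingleton (M j)) :
    ∃ φ : (∀ j, M j) ≃ₗ[ℝ] ⨁ j, M j, ∀ f j, DirectSum.component ℝ ℕ M j (φ f) = f j := by
  let ψ : (⨁ j, M j) →ₗ[ℝ] ∀ j, M j := LinearMap.pi fun j => DirectSum.component ℝ ℕ M j
  have hψ : Function.Bijective ψ := by
    refine ⟨fun x y h => DFinsupp.ext fun j => congr_fun h j, fun f =>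
      ⟨DFinsupp.mk (β := M) (Finset.range N) fun j => f j, funext fun j => ?_⟩⟩
    by_cases hj : j < N
    · exact (DFinsupp.mk_of_mem (β := M) (s := Finset.range N) (x := fun j => f j)
        (Finset.mem_range.2 hj))
    · have := hM j (not_lt.1 hj)
      exact Subsingleton.elim _ _
  refine ⟨(LinearEquiv.ofBijective ψ hψ).symm, fun f j => ?_⟩
  exact congr_fun ((LinearEquiv.ofBijective ψ hψ).apply_symm_apply f) j

lemma exists_HKc_equiv (d : A →ₗ[ℝ] A) (P Q : ℤ → Submodule ℝ A) (n : ℤ) :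
    ∃ θ : HKc d 0 P Q n ≃ₗ[ℝ] HOm d P n × HG d 0 P Q (n - 1),
      ∀ (x : A × A) (hx : x ∈ ZKc d 0 P Q n)
        (h1 : x.1 ∈ ZOm d P n) (h2 : x.2 ∈ ZG d 0 P Q (n - 1)),
        θ (Submodule.Quotient.mk ⟨x, hx⟩) =
          (Submodule.Quotient.mk ⟨x.1, h1⟩, Submodule.Quotient.mk ⟨x.2, h2⟩) := by
  have hZ (x : A × A) :
      x ∈ ZKc d 0 P Q n ↔ x.1 ∈ ZOm d P n ∧ x.2 ∈ ZG d 0 P Q (n - 1) := by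
    simp only [ZKc, ZOm, ZG, mem_inf, mem_Ksub_zero, LinearMap.mem_ker, Dmap_zero_apply,
      Prod.mk_eq_zero]
    tauto
  let f : ZKc d 0 P Q n →ₗ[ℝ] HOm d P n × HG d 0 P Q (n - 1) :=
    (mkQ _ ∘ₗ (LinearMap.fst ℝ A A).restrict fun x hx => ((hZ x).1 hx).1).prod
      (mkQ _ ∘ₗ (LinearMap.snd ℝ A A).restrict fun x hx => ((hZ x).1 hx).2)
  obtain ⟨θ, hθ⟩ := exists_Hq_equiv (B := BKc d 0 P Q n) f (by
    rintro ⟨a, b⟩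
    obtain ⟨a, rfl⟩ := Submodule.mkQ_surjective _ a
    obtain ⟨b, rfl⟩ := Submodule.mkQ_surjective _ b
    exact ⟨⟨(a, b), (hZ _).2 ⟨a.2, b.2⟩⟩, rfl⟩) (by
    intro z
    have h : f z = 0 ↔ (z : A × A).1 ∈ BOm d P n ∧ (z : A × A).2 ∈ BG d 0 P Q (n - 1) := by
      rw [Prod.ext_iff]
      exact and_congr (Submodule.Quotient.mk_eq_zero _) (Submodule.Quotient.mk_eq_zero _)
    rw [h]
    constructor
    · rintro ⟨⟨a, ha, ha'⟩, ⟨b, hb, hb'⟩⟩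
      exact ⟨(a, b), mem_Ksub_zero.2 ⟨ha, hb⟩,
        (Dmap_zero_apply _ _).trans (Prod.ext ha' hb')⟩
    · rintro ⟨x, hx, hxz⟩
      rw [Dmap_zero_apply] at hxz
      rw [← hxz]
      have hx' := mem_Ksub_zero.1 hx
      exact ⟨⟨x.1, hx'.1, rfl⟩, ⟨x.2, hx'.2, rfl⟩⟩)
  exact ⟨θ, fun x hx h1 h2 => hθ ⟨x, hx⟩⟩

open DirectSum in
lemma exists_HC_equiv {d : A →ₗ[ℝ] A} (hd : d ∘ₗ d = 0) {P : ℤ → Submodule ℝ A}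
    (Q : ℤ → Submodule ℝ A) (hPneg : ∀ n : ℤ, n < 0 → P n = ⊥) (n : ℤ) :
    ∃ Θ : HC d 0 P Q n ≃ₗ[ℝ] HOm d P n × ⨁ j : ℕ, HKo d 0 P Q (n - 2 * ((j : ℤ) + 1)),
      ∀ (ω : ℕ → A × A) (hω : ω ∈ ZC d 0 P Q n) (h0 : (ω 0).1 ∈ ZOm d P n)
        (hj : ∀ j : ℕ, (ω (j + 1)).1 ∈ ZKo d 0 P Q (n - 2 * ((j : ℤ) + 1))),
        (Θ (Submodule.Quotient.mk ⟨ω, hω⟩)).1 = Submodule.Quotient.mk ⟨(ω 0).1, h0⟩ ∧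
        ∀ j : ℕ,
          DirectSum.component ℝ ℕ (fun j : ℕ => HKo d 0 P Q (n - 2 * ((j : ℤ) + 1))) j
              (Θ (Submodule.Quotient.mk ⟨ω, hω⟩)).2 =
            Submodule.Quotient.mk ⟨(ω (j + 1)).1, hj j⟩ := by
  have hZ (ω : ℕ → A × A) (hω : ω ∈ ZC d 0 P Q n) := (mem_ZC_zero_iff hd).1 hω
  let coeff (j : ℕ) : (ℕ → A × A) →ₗ[ℝ] A := LinearMap.fst ℝ A A ∘ₗ LinearMap.proj j
  let f : ZC d 0 P Q n →ₗ[ℝ] HOm d P n × ∀ j : ℕ, HKo d 0 P Q (n - 2 * ((j : ℤ) + 1)) :=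
    (mkQ _ ∘ₗ (coeff 0).restrict fun ω hω => (hZ ω hω).1).prod
      (LinearMap.pi fun j => mkQ _ ∘ₗ (coeff (j + 1)).restrict fun ω hω => ((hZ ω hω).2 j).1)
  obtain ⟨Θ, hΘ⟩ := exists_Hq_equiv (B := BC d 0 P Q n) f (by
    rintro ⟨a, b⟩
    obtain ⟨a, rfl⟩ := Submodule.mkQ_surjective _ a
    choose c hc using fun j => Submodule.mkQ_surjective _ (b j)
    exact ⟨⟨fun j => (Nat.casesOn j a fun j => c j, ((-1 : ℝ) ^ n) • d (c j)),
      (mem_ZC_zero_iff hd).2 ⟨a.2, fun j => ⟨(c j).2, rfl⟩⟩⟩, Prod.ext rfl (funext hc)⟩) (by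
    intro z
    rw [mem_BC_zero_iff hd z.2, Prod.ext_iff, funext_iff]
    exact and_congr (Submodule.Quotient.mk_eq_zero _)
      (forall_congr' fun j => Submodule.Quotient.mk_eq_zero _))
  obtain ⟨φ, hφ⟩ := exists_pi_equiv_directSum
    (M := fun j : ℕ => HKo d 0 P Q (n - 2 * ((j : ℤ) + 1))) n.toNat
    fun j hj => subsingleton_HKo hPneg (by omega)
  refine ⟨Θ.trans ((LinearEquiv.refl ℝ _).prodCongr φ), fun ω hω h0 hj => ⟨?_, fun j => ?_⟩⟩
  · exact congr_arg Prod.fst (hΘ ⟨ω, hω⟩)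
  · exact (hφ _ j).trans (congr_fun (congr_arg Prod.snd (hΘ ⟨ω, hω⟩)) j)

open DirectSum in
/-- suppose `ε = 0`.  Then `K^n = Ω^n × G^(n-1)` with `D(α,β) = (dα,dβ)`,
so `H^n(K) ≅ H^n(Ω) ⊕ H^(n-1)(G)`; and for every `n` there is an isomorphism
`H^n(C) ≅ H^n(Ω) ⊕ ⊕_{j≥1} H^(n-2j)(𝒦)` (sending the class of a cocycle to the
classes of the coefficients of `u^0, u^1, u^2, …`).  Under this isomorphism the
`ℝ[u]`-module structure of `H^*(C)` is `u·(b₀, b̄₁, b̄₂, …) = (0, Pr(b₀), b̄₁, b̄₂, …)`,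
with `Pr : H^n(Ω) → H^n(𝒦)` induced by the projection `Ω → 𝒦`.  (The target of `u`
is `H^(n+2)(C) ≅ H^(n+2)(Ω) ⊕ ⊕_{j≥1} H^(n+2-2j)(𝒦)`, whose `𝒦`-part is indexed here
as `⊕_{j:ℕ} H^(n-2j)(𝒦)`.) -/
theorem statement_17 {A : Type*} [AddCommGroup A] [Module ℝ A]
    (d e : A →ₗ[ℝ] A) (hd : d ∘ₗ d = 0) (hde : d ∘ₗ e = e ∘ₗ d)
    (P Q : ℤ → Submodule ℝ A) (hQP : ∀ n, Q n ≤ P n)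
    (hPneg : ∀ n : ℤ, n < 0 → P n = ⊥) (hQneg : ∀ n : ℤ, n < 0 → Q n = ⊥)
    (he : e = 0) :
    -- K^n = Ω^n × G^(n-1), D = (d, d)
    (∀ n : ℤ, Ksub d e P Q n = (Om d P n).prod (Gsub d e P Q (n - 1))) ∧
    (∀ (n : ℤ) (x : A × A), Dmap d e n x = (d x.1, d x.2)) ∧
    -- H^n(K) ≅ H^n(Ω) ⊕ H^(n-1)(G)
    (∀ n : ℤ, ∃ θ : HKc d e P Q n ≃ₗ[ℝ] HOm d P n × HG d e P Q (n - 1),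
      ∀ (x : A × A) (hx : x ∈ ZKc d e P Q n)
        (h1 : x.1 ∈ ZOm d P n) (h2 : x.2 ∈ ZG d e P Q (n - 1)),
        θ (Submodule.Quotient.mk ⟨x, hx⟩) =
          (Submodule.Quotient.mk ⟨x.1, h1⟩, Submodule.Quotient.mk ⟨x.2, h2⟩)) ∧
    -- H^n(C) ≅ H^n(Ω) ⊕ ⊕_{j≥1} H^(n-2j)(𝒦), and the ℝ[u]-structure under it
    (∀ n : ℤ,
      ∃ Θ : HC d e P Q n ≃ₗ[ℝ] HOm d P n × ⨁ j : ℕ, HKo d e P Q (n - 2 * ((j : ℤ) + 1)),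
        (∀ (ω : ℕ → A × A) (hω : ω ∈ ZC d e P Q n) (h0 : (ω 0).1 ∈ ZOm d P n)
          (hj : ∀ j : ℕ, (ω (j + 1)).1 ∈ ZKo d e P Q (n - 2 * ((j : ℤ) + 1))),
          (Θ (Submodule.Quotient.mk ⟨ω, hω⟩)).1 = Submodule.Quotient.mk ⟨(ω 0).1, h0⟩ ∧
          ∀ j : ℕ,
            DirectSum.component ℝ ℕ (fun j : ℕ => HKo d e P Q (n - 2 * ((j : ℤ) + 1))) j
                (Θ (Submodule.Quotient.mk ⟨ω, hω⟩)).2 =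
              Submodule.Quotient.mk ⟨(ω (j + 1)).1, hj j⟩) ∧
        ∀ Θ' : HC d e P Q (n + 2) ≃ₗ[ℝ] HOm d P (n + 2) × ⨁ j : ℕ, HKo d e P Q (n - 2 * (j : ℤ)),
          (∀ (ω : ℕ → A × A) (hω : ω ∈ ZC d e P Q (n + 2)) (h0 : (ω 0).1 ∈ ZOm d P (n + 2))
            (hj : ∀ j : ℕ, (ω (j + 1)).1 ∈ ZKo d e P Q (n - 2 * (j : ℤ))),
            (Θ' (Submodule.Quotient.mk ⟨ω, hω⟩)).1 = Submodule.Quotient.mk ⟨(ω 0).1, h0⟩ ∧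
            ∀ j : ℕ,
              DirectSum.component ℝ ℕ (fun j : ℕ => HKo d e P Q (n - 2 * (j : ℤ))) j
                  (Θ' (Submodule.Quotient.mk ⟨ω, hω⟩)).2 =
                Submodule.Quotient.mk ⟨(ω (j + 1)).1, hj j⟩) →
          -- u· : H^n(C) → H^(n+2)(C), induced by the shift ω ↦ u·ω
          ∀ UH : HC d e P Q n →ₗ[ℝ] HC d e P Q (n + 2),
            (∀ (ω : ℕ → A × A) (hω : ω ∈ ZC d e P Q n)
              (h2 : shiftL (A × A) ω ∈ ZC d e P Q (n + 2)),
              UH (Submodule.Quotient.mk ⟨ω, hω⟩) =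
                Submodule.Quotient.mk ⟨shiftL (A × A) ω, h2⟩) →
          -- Pr : H^n(Ω) → H^n(𝒦)
          ∀ Pr0 : HOm d P n →ₗ[ℝ] HKo d e P Q (n - 2 * ((0 : ℕ) : ℤ)),
            prChar d e P Q n (n - 2 * ((0 : ℕ) : ℤ)) Pr0 →
            ∀ x : HC d e P Q n,
              (Θ' (UH x)).1 = 0 ∧
              DirectSum.component ℝ ℕ (fun j : ℕ => HKo d e P Q (n - 2 * (j : ℤ))) 0
                  (Θ' (UH x)).2 = Pr0 (Θ x).1 ∧
              ∀ j : ℕ,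
                DirectSum.component ℝ ℕ (fun j : ℕ => HKo d e P Q (n - 2 * (j : ℤ))) (j + 1)
                    (Θ' (UH x)).2 =
                  DirectSum.component ℝ ℕ
                    (fun j : ℕ => HKo d e P Q (n - 2 * ((j : ℤ) + 1))) j (Θ x).2) := by
  subst he
  refine ⟨fun n => ?_, Dmap_zero_apply, exists_HKc_equiv d P Q, fun n => ?_⟩
  · ext x
    exact mem_Ksub_zero
  obtain ⟨Θ, hΘ⟩ := exists_HC_equiv hd Q hPneg n
  refine ⟨Θ, hΘ, fun Θ' hΘ' UH hUH Pr0 hPr x => ?_⟩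
  obtain ⟨⟨ω, hω⟩, rfl⟩ := Submodule.Quotient.mk_surjective _ x
  obtain ⟨h0, h⟩ := (mem_ZC_zero_iff hd).1 hω
  have hs := shiftL_mem_ZC hd hω
  have h0' : (shiftL (A × A) ω 0).1 ∈ ZOm d P (n + 2) := ((mem_ZC_zero_iff hd).1 hs).1
  have hpr : (ω 0).1 ∈ ZKo d 0 P Q (n - 2 * ((0 : ℕ) : ℤ)) := by simpa using ZOm_le_ZKo n h0
  have hj (j : ℕ) : (shiftL (A × A) ω (j + 1)).1 ∈ ZKo d 0 P Q (n - 2 * (j : ℤ)) := by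
    cases j with
    | zero => exact hpr
    | succ j => exact (h j).1
  obtain ⟨hfst, hsnd⟩ := hΘ' _ hs h0' hj
  obtain ⟨gfst, gsnd⟩ := hΘ ω hω h0 fun j => (h j).1
  rw [hUH ω hω hs]
  refine ⟨?_, ?_, fun j => ?_⟩
  · rw [hfst]
    exact (Submodule.Quotient.mk_eq_zero _).2 (Submodule.zero_mem _)
  · rw [hsnd, gfst, hPr _ h0 hpr]
    rfl
  · rw [hsnd, gsnd]
    rfl

end IG

end
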